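/- arXiv:0809.0346 — 2 statements merged into one kernel-verified Lean document; each statement's English description precedes it below -/
import Mathlib

section
/- Let G be a power-commutative group and let a, b ∈ G satisfy both a·b·a·b·a·b⁻¹·a²·b⁻¹ = 1 and a·b⁻¹·a·b²·a⁻¹·b²·a·b⁻¹·a·b² = 1. Then a and b commute. -/
/-- In a power-commutative group, the relations `a b a b a b⁻¹ a² b⁻¹ = 1` and
`a b⁻¹ a b² a⁻¹ b² a b⁻¹ a b² = 1` force `a` and `b` to commute. -/
theorem stmt16 {G : Type*} [Group G]
    (hPC : ∀ x y : G, ∀ p q : ℤ, p ≠ 0 → q ≠ 0 → Commute (x ^ p) (y ^ q) → Commute x y)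
    (a b : G)
    (hrel1 : a * b * a * b * a * b⁻¹ * a ^ 2 * b⁻¹ = 1)
    (hrel2 : a * b⁻¹ * a * b ^ 2 * a⁻¹ * b ^ 2 * a * b⁻¹ * a * b ^ 2 = 1) :
    Commute a b := by
  obtain ⟨w, hw⟩ : ∃ w, w = a * b⁻¹ * a * b ^ 2 := ⟨_, rfl⟩
  have h2 : w * (a⁻¹ * b ^ 2) * w = 1 := by
    rw [← hrel2, hw]; group
  have hww : w * w = (b ^ 2)⁻¹ * a := by
    have h3 : a⁻¹ * b ^ 2 = w⁻¹ * (w * (a⁻¹ * b ^ 2) * w) * w⁻¹ := by group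
    rw [h2] at h3
    have h4 : w * w = (a⁻¹ * b ^ 2)⁻¹ := by rw [h3]; simp
    rw [h4]; group
  have hx : (w * b * w) * (w * b * w) = b * b := by
    have e1 : (w * b * w) * (w * b * w) = w * b * (w * w) * b * w := by group
    have e3 : a * b⁻¹ * a * b * a * b * a * b⁻¹ * a = 1 := by
      have : a * b⁻¹ * a * b * a * b * a * b⁻¹ * a =
        (a * b⁻¹) * (a * b * a * b * a * b⁻¹ * a ^ 2 * b⁻¹) * (a * b⁻¹)⁻¹ := by
        group
      rw [this, hrel1]; group
    have e4 : w * b * (w * w) * b * w =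
        (a * b⁻¹ * a * b * a * b * a * b⁻¹ * a) * (b * b) := by
      rw [hww, hw]; simp [pow_two, mul_assoc]
    rw [e1, e4, e3, one_mul]
  have c1 : Commute (w * b * w) b := by
    apply hPC _ _ 2 2 (by norm_num) (by norm_num)
    rw [zpow_two, zpow_two, hx]
  have c2 : Commute (w * b) b := by
    apply hPC _ _ 4 4 (by norm_num) (by norm_num)
    have : (w * b) ^ (4 : ℤ) = b ^ (4 : ℤ) := by
      have e : (w * b) ^ (4 : ℤ) = (w * b * w) * (b * (w * b * w)) * b := by
        simp [zpow_ofNat, pow_succ, mul_assoc]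
      rw [e, ← c1.eq, ← mul_assoc, hx]; simp [zpow_ofNat, pow_succ, mul_assoc]
    rw [this]
  have c3 : Commute w b := by
    have := c2.mul_left (Commute.refl b).inv_left
    simpa using this
  have ha : a = b ^ 2 * (w * w) := by rw [hww]; group
  rw [ha]
  exact ((Commute.refl b).pow_left 2).mul_left (c3.mul_left c3)
end

section
/- Let G be a power-commutative group and let a, b ∈ G satisfy both a·b·a·b·a·b·a·b⁻¹·a⁻¹·b·a⁻¹·b⁻¹ = 1 and a·b²·a·b⁻¹·a²·b⁻¹ = 1. Then a and b commute. -/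
/-- In a power-commutative group, the relations
`a b a b a b a b⁻¹ a⁻¹ b a⁻¹ b⁻¹ = 1` and `a b² a b⁻¹ a² b⁻¹ = 1` force `a`
and `b` to commute. -/
theorem stmt19 {G : Type*} [Group G]
    (hPC : ∀ x y : G, ∀ p q : ℤ, p ≠ 0 → q ≠ 0 → Commute (x ^ p) (y ^ q) → Commute x y)
    (a b : G)
    (hrel1 : a * b * a * b * a * b * a * b⁻¹ * a⁻¹ * b * a⁻¹ * b⁻¹ = 1)
    (hrel2 : a * b ^ 2 * a * b⁻¹ * a ^ 2 * b⁻¹ = 1) :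
    Commute a b := by
  have h1 : (a⁻¹ * b * a⁻¹) ^ 2 = b ^ 2 := by
    have h : a * b ^ 2 * a = (b⁻¹ * a ^ 2 * b⁻¹)⁻¹ := by
      apply eq_inv_of_mul_eq_one_left
      simpa only [mul_assoc] using hrel2
    have h' : b ^ 2 = a⁻¹ * (a * b ^ 2 * a) * a⁻¹ := by group
    rw [h', h, pow_two (_ * _)]
    group
  have h2 : Commute (a⁻¹ * b * a⁻¹) b := by
    apply hPC _ _ 2 2 (by norm_num) (by norm_num)
    rw [zpow_ofNat, zpow_ofNat, h1]
  have h3 : Commute a (b * a⁻¹) := by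
    apply hPC _ _ 1 2 (by norm_num) (by norm_num)
    have h := h2.eq
    rw [zpow_one, zpow_ofNat, pow_two]
    have e : a * (b * a⁻¹ * (b * a⁻¹)) = a * (b * (a⁻¹ * b * a⁻¹)) := by
      simp only [mul_assoc]
    show _ = _
    rw [e, ← h]
    group
  have h4 := h3.mul_right (Commute.refl a)
  simpa using h4
end
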